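/- Let a, b, λ be real numbers with ab ≠ 0, a ≠ b, and a + b ≠ 0, and set H = a + b and S = a² + b². If λ(a³ + b³) = S(S − 1), (1 + a(λ − H))·(2(1 + a(λ − H))(b² + 3a²) − 3λb(a − b)²) = 0, and (1 + b(λ − H))·(2(1 + b(λ − H))(3b² + a²) − 3λa(a − b)²) = 0, then a contradiction follows (no such real numbers exist). -/

import Mathlib

/-- The mixed case, in terms of the ratio `t = b / a`, with `m = lam * a` and `x = a ^ 2`. -/
lemma mixed_factors_ne_zero {t m x : ℝ} (ht : t ≠ 0) (ht1 : t ≠ 1)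
    (hP : 1 + m - x * (1 + t) = 0)
    (hQ : 2 * (1 + t * m - x * t * (1 + t)) * (3 * t ^ 2 + 1) = 3 * m * (1 - t) ^ 2)
    (hS : m * (1 + t ^ 3) = (1 + t ^ 2) * (x * (1 + t ^ 2) - 1)) : False := by
  have ht' : 1 - t ≠ 0 := sub_ne_zero.mpr ht1.symm
  obtain rfl : m = x * (1 + t) - 1 := by linear_combination hP
  have hx : 3 * (1 - t ^ 2) * x = 6 * t ^ 2 - 3 * t + 5 := by
    apply mul_left_cancel₀ ht'
    linear_combination -hQ
  have key : t * (1 - t) ^ 2 * (9 * t ^ 2 + 5) = 0 := by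
    linear_combination 3 * (1 - t ^ 2) * hS +
      ((1 + t ^ 2) ^ 2 - (1 + t) * (1 + t ^ 3)) * hx
  have : 9 * t ^ 2 + 5 ≠ 0 := by positivity
  simp_all

/-- The case where both second factors vanish, in terms of the ratio `t = b / a`,
with `m = lam * a` and `x = a ^ 2`: three linear equations in `(m, x)` whose
augmented determinant does not vanish. -/
lemma second_factors_ne_zero {t m x : ℝ} (ht : t ≠ 0) (ht1 : t ≠ 1)
    (hP : 2 * (1 + m - x * (1 + t)) * (t ^ 2 + 3) = 3 * m * t * (1 - t) ^ 2)
    (hQ : 2 * (1 + t * m - x * t * (1 + t)) * (3 * t ^ 2 + 1) = 3 * m * (1 - t) ^ 2)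
    (hS : m * (1 + t ^ 3) = (1 + t ^ 2) * (x * (1 + t ^ 2) - 1)) : False := by
  have ht' : 1 - t ≠ 0 := sub_ne_zero.mpr ht1.symm
  have key : t * (1 - t) ^ 3 * (3 * (3 * t ^ 2 + 1) * (1 + t ^ 2) +
      (t ^ 2 + 3) * (2 * (3 * t ^ 2 + 1) + 3 + 3 * t ^ 2)) = 0 := by
    linear_combination (-1 / 2 : ℝ) * (
      ((2 * t * (3 * t ^ 2 + 1) - 3 * (1 - t) ^ 2) * (-(1 + t ^ 2) ^ 2) +
        2 * t * (3 * t ^ 2 + 1) * (1 + t) * (1 + t ^ 3)) * hP -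
      ((2 * (t ^ 2 + 3) - 3 * t * (1 - t) ^ 2) * (-(1 + t ^ 2) ^ 2) +
        2 * (t ^ 2 + 3) * (1 + t) * (1 + t ^ 3)) * hQ +
      ((2 * (t ^ 2 + 3) - 3 * t * (1 - t) ^ 2) * (-2 * t * (3 * t ^ 2 + 1) * (1 + t)) +
        2 * (t ^ 2 + 3) * (1 + t) * (2 * t * (3 * t ^ 2 + 1) - 3 * (1 - t) ^ 2)) * hS)
  have : 3 * (3 * t ^ 2 + 1) * (1 + t ^ 2) +
      (t ^ 2 + 3) * (2 * (3 * t ^ 2 + 1) + 3 + 3 * t ^ 2) ≠ 0 := by positivity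
  simp_all

lemma first_factor_ne_zero {a b lam : ℝ} (ha : a ≠ 0) (hb : b ≠ 0) (hne : a ≠ b)
    (h1 : lam * (a ^ 3 + b ^ 3) = (a ^ 2 + b ^ 2) * (a ^ 2 + b ^ 2 - 1))
    (h3 : 2 * (1 + b * (lam - (a + b))) * (3 * b ^ 2 + a ^ 2) -
      3 * lam * a * (a - b) ^ 2 = 0) :
    1 + a * (lam - (a + b)) ≠ 0 ∧
      2 * (1 + a * (lam - (a + b))) * (b ^ 2 + 3 * a ^ 2) -
        3 * lam * b * (a - b) ^ 2 ≠ 0 := by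
  obtain ⟨t, rfl⟩ : ∃ t, b = t * a := ⟨b / a, by field_simp⟩
  have ht : t ≠ 0 := left_ne_zero_of_mul hb
  have ht1 : t ≠ 1 := by
    rintro rfl
    simp at hne
  have ha2 : a ^ 2 ≠ 0 := pow_ne_zero 2 ha
  have hS : lam * a * (1 + t ^ 3) = (1 + t ^ 2) * (a ^ 2 * (1 + t ^ 2) - 1) := by
    apply mul_left_cancel₀ ha2
    linear_combination h1
  have hQ : 2 * (1 + t * (lam * a) - a ^ 2 * t * (1 + t)) * (3 * t ^ 2 + 1) =
      3 * (lam * a) * (1 - t) ^ 2 := by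
    apply mul_left_cancel₀ ha2
    linear_combination h3
  constructor
  · intro h2
    exact mixed_factors_ne_zero ht ht1 (by linear_combination h2) hQ hS
  · intro h2
    refine second_factors_ne_zero ht ht1 ?_ hQ hS
    apply mul_left_cancel₀ ha2
    linear_combination h2

theorem stmt_9 (a b lam : ℝ) (hab : a * b ≠ 0) (hne : a ≠ b) (hsum : a + b ≠ 0)
    (H S : ℝ) (hH : H = a + b) (hS : S = a ^ 2 + b ^ 2)
    (h1 : lam * (a ^ 3 + b ^ 3) = S * (S - 1))
    (h2 : (1 + a * (lam - H)) *
      (2 * (1 + a * (lam - H)) * (b ^ 2 + 3 * a ^ 2) - 3 * lam * b * (a - b) ^ 2) = 0)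
    (h3 : (1 + b * (lam - H)) *
      (2 * (1 + b * (lam - H)) * (3 * b ^ 2 + a ^ 2) - 3 * lam * a * (a - b) ^ 2) = 0) :
    False := by
  subst hH hS
  have ha : a ≠ 0 := left_ne_zero_of_mul hab
  have hb : b ≠ 0 := right_ne_zero_of_mul hab
  rcases mul_eq_zero.mp h3 with hQ | hQ
  · rcases mul_eq_zero.mp h2 with hP | hP
    · have h : (a - b) * (lam - (a + b)) = 0 := by linear_combination hP - hQ
      rcases mul_eq_zero.mp h with h | h
      · exact hne (sub_eq_zero.mp h)
      · simp [h] at hP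
    · refine (first_factor_ne_zero (lam := lam) hb ha hne.symm ?_ ?_).1 ?_
      · linear_combination h1
      · linear_combination hP
      · linear_combination hQ
  · have h := first_factor_ne_zero ha hb hne h1 hQ
    exact (mul_ne_zero h.1 h.2) h2
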